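/- Let M be a synchronous machine and β a candidate L view. If there exists an H strategy π (defined on all candidate H views) that excludes β, then there exists an H strategy π' that also excludes β and has the property that for all candidate H views α and α', if K(α, π', β) = K(α', π', β) and |α| = |α'| then π'(α) = π'(α'). -/

import Mathlib

/-- A synchronous machine (without the input-enabledness proof, which is
stated separately as `SyncMachine.InputEnabled`). -/
structure SyncMachine (S AH AL O : Type) where
  init : S
  trans : S → AH × AL → S → Prop
  obsH : S → O
  obsL : S → O

namespace SyncMachine

variable {S AH AL O : Type}

/-- The machine is input-enabled. -/
def InputEnabled (M : SyncMachine S AH AL O) : Prop :=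
  ∀ s a, ∃ t, M.trans s a t

/-- A step of a run: a joint action together with the resulting state. -/
abbrev Step (S AH AL : Type) := (AH × AL) × S

def IsRunFrom (M : SyncMachine S AH AL O) : S → List (Step S AH AL) → Prop
  | _, [] => True
  | s, (a, t) :: rest => M.trans s a t ∧ M.IsRunFrom t rest

/-- A run of the machine, starting at the initial state; represented as its
list of steps. -/
def IsRun (M : SyncMachine S AH AL O) (r : List (Step S AH AL)) : Prop :=
  M.IsRunFrom M.init r

/-- The final state of a run. -/
def final (M : SyncMachine S AH AL O) (r : List (Step S AH AL)) : S :=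
  r.foldl (fun _ st => st.2) M.init

/-- The sequence of `H` actions of a run. -/
def actH (r : List (Step S AH AL)) : List AH := r.map (fun st => st.1.1)

/-- The `H` view of a run: the initial `H` observation followed by the
alternating sequence of `H` actions and `H` observations. -/
def viewH (M : SyncMachine S AH AL O) (r : List (Step S AH AL)) : O × List (AH × O) :=
  (M.obsH M.init, r.map (fun st => (st.1.1, M.obsH st.2)))

/-- The `L` view of a run. -/
def viewL (M : SyncMachine S AH AL O) (r : List (Step S AH AL)) : O × List (AL × O) :=
  (M.obsL M.init, r.map (fun st => (st.1.2, M.obsL st.2)))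

/-- An `H` strategy: a map from (candidate) `H` views to `H` actions. -/
abbrev Strategy (AH O : Type) := O × List (AH × O) → AH

def ConsistentFrom (M : SyncMachine S AH AL O) (π : Strategy AH O) :
    O × List (AH × O) → List (Step S AH AL) → Prop
  | _, [] => True
  | v, (a, t) :: rest =>
      a.1 = π v ∧ M.ConsistentFrom π (v.1, v.2 ++ [(a.1, M.obsH t)]) rest

/-- A run is consistent with an `H` strategy `π` if each of its `H` actions is
the one prescribed by `π` on the `H` view of the preceding prefix of the run. -/
def Consistent (M : SyncMachine S AH AL O) (π : Strategy AH O)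
    (r : List (Step S AH AL)) : Prop :=
  M.ConsistentFrom π (M.obsH M.init, []) r

/-- `Run(M, π)`: the runs of `M` consistent with `π`. -/
def stratRuns (M : SyncMachine S AH AL O) (π : Strategy AH O) :
    Set (List (Step S AH AL)) :=
  { r | M.IsRun r ∧ M.Consistent π r }

/-- The set of `L` views of a set of runs. -/
def lviews (M : SyncMachine S AH AL O) (R : Set (List (Step S AH AL))) :
    Set (O × List (AL × O)) :=
  M.viewL '' R

/-- Nondeducibility on strategies. -/
def NDS (M : SyncMachine S AH AL O) : Prop :=
  ∀ π₁ π₂ : Strategy AH O, M.lviews (M.stratRuns π₁) = M.lviews (M.stratRuns π₂)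

/-- Nondeducibility on inputs. -/
def NDI (M : SyncMachine S AH AL O) : Prop :=
  ∀ r : List (Step S AH AL), M.IsRun r →
    ∀ α : List AH, α.length = r.length →
      ∃ r', M.IsRun r' ∧ actH r' = α ∧ M.viewL r' = M.viewL r

/-- A synchronous unwinding relation on `M`. -/
def Unwinding (M : SyncMachine S AH AL O) (R : S → S → Prop) : Prop :=
  Symmetric R ∧ R M.init M.init ∧
  (∀ s t, R s t → M.obsL s = M.obsL t) ∧
  (∀ s t, R s t → ∀ (a₁ a₂ : AH) (a₃ : AL) (s' : S), M.trans s (a₁, a₃) s' →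
    ∃ t', M.trans t (a₂, a₃) t' ∧ R s' t')

/-- Restrictiveness: there exists a synchronous unwinding relation. -/
def RES (M : SyncMachine S AH AL O) : Prop :=
  ∃ R, M.Unwinding R

end SyncMachine


namespace SyncMachine

variable {S AH AL O : Type}

/-- `δ_{a_H,o_H,a_L,o_L}(T)`. -/
def delta4 (M : SyncMachine S AH AL O) (aH : AH) (oH : O) (aL : AL) (oL : O)
    (T : Set S) : Set S :=
  { s | ∃ t ∈ T, M.trans t (aH, aL) s ∧ M.obsH s = oH ∧ M.obsL s = oL }

/-- `K(α, π, β)`: the set of final states of runs `r` consistent with `π`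
such that `view_H(r) = α` and `view_L(r)` is a prefix of `β`. -/
def Kstrat (M : SyncMachine S AH AL O) (π : Strategy AH O)
    (α : O × List (AH × O)) (β : O × List (AL × O)) : Set S :=
  { s | ∃ r, M.IsRun r ∧ M.Consistent π r ∧ M.viewH r = α ∧
        (M.viewL r).1 = β.1 ∧ (M.viewL r).2 <+: β.2 ∧ M.final r = s }

/-- The strategy `π` excludes the candidate `L` view `β` if no run consistent
with `π` has `L` view `β`. -/
def Excludes (M : SyncMachine S AH AL O) (π : Strategy AH O)
    (β : O × List (AL × O)) : Prop :=
  ¬ ∃ r, M.IsRun r ∧ M.Consistent π r ∧ M.viewL r = β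

end SyncMachine

namespace SyncMachine

variable {S AH AL O : Type}

theorem _root_.List.append_singleton_prefix_iff {α : Type*} (l m : List α) (x : α) :
    l ++ [x] <+: m ↔ l <+: m ∧ m[l.length]? = some x := by
  constructor
  · rintro ⟨t, rfl⟩
    simp [List.append_assoc]
  · rintro ⟨⟨t, rfl⟩, h⟩
    cases t with
    | nil => simp at h
    | cons y t => exact ⟨t, by simp_all⟩

theorem isRunFrom_append_singleton (M : SyncMachine S AH AL O) (s : S)
    (r : List (Step S AH AL)) (st : Step S AH AL) :
    M.IsRunFrom s (r ++ [st]) ↔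
      M.IsRunFrom s r ∧ M.trans (r.foldl (fun _ st => st.2) s) st.1 st.2 := by
  induction r generalizing s with
  | nil => simp [IsRunFrom]
  | cons x r ih => simp [IsRunFrom, ih, and_assoc]

theorem isRun_append_singleton (M : SyncMachine S AH AL O)
    (r : List (Step S AH AL)) (st : Step S AH AL) :
    M.IsRun (r ++ [st]) ↔ M.IsRun r ∧ M.trans (M.final r) st.1 st.2 :=
  M.isRunFrom_append_singleton M.init r st

theorem consistentFrom_append_singleton (M : SyncMachine S AH AL O) (π : Strategy AH O)
    (v : O × List (AH × O)) (r : List (Step S AH AL)) (st : Step S AH AL) :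
    M.ConsistentFrom π v (r ++ [st]) ↔
      M.ConsistentFrom π v r ∧
        st.1.1 = π (v.1, v.2 ++ r.map (fun st => (st.1.1, M.obsH st.2))) := by
  induction r generalizing v with
  | nil => simp [ConsistentFrom]
  | cons x r ih => simp [ConsistentFrom, ih, and_assoc]

theorem consistent_append_singleton (M : SyncMachine S AH AL O) (π : Strategy AH O)
    (r : List (Step S AH AL)) (st : Step S AH AL) :
    M.Consistent π (r ++ [st]) ↔ M.Consistent π r ∧ st.1.1 = π (M.viewH r) := by
  simp [Consistent, consistentFrom_append_singleton, viewH]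

/-- The states `H` considers possible before any action, given the initial observation `o`
and the candidate `L` view `β`. -/
def initialKnowledge (M : SyncMachine S AH AL O) (β : O × List (AL × O)) (o : O) : Set S :=
  { s | s = M.init ∧ M.obsH M.init = o ∧ M.obsL M.init = β.1 }

theorem Kstrat_nil (M : SyncMachine S AH AL O) (π : Strategy AH O)
    (β : O × List (AL × O)) (o : O) :
    M.Kstrat π (o, []) β = M.initialKnowledge β o := by
  ext s
  constructor
  · rintro ⟨r, -, -, hv, hβ, -, rfl⟩
    simp only [viewH, Prod.mk.injEq, List.map_eq_nil_iff] at hv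
    obtain ⟨ho, rfl⟩ := hv
    exact ⟨rfl, ho, hβ⟩
  · rintro ⟨rfl, ho, hβ⟩
    exact ⟨[], trivial, trivial, by simp [viewH, ho], hβ, by simp [viewL], rfl⟩

theorem Kstrat_append_singleton (M : SyncMachine S AH AL O) (π : Strategy AH O)
    (β : O × List (AL × O)) (o : O) (h : List (AH × O)) (a : AH) (x : O) :
    M.Kstrat π (o, h ++ [(a, x)]) β =
      { s | ∃ b p, β.2[h.length]? = some (b, p) ∧ a = π (o, h) ∧
        s ∈ M.delta4 a x b p (M.Kstrat π (o, h) β) } := by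
  ext s
  constructor
  · rintro ⟨r, hr, hc, hv, hβ, hp, rfl⟩
    rcases List.eq_nil_or_concat' r with rfl | ⟨r, ⟨⟨a', b⟩, t⟩, rfl⟩
    · simp [viewH] at hv
    · rw [isRun_append_singleton] at hr
      rw [consistent_append_singleton] at hc
      simp only [viewH, List.map_append, List.map_cons, List.map_nil, Prod.mk.injEq] at hv
      obtain ⟨rfl, hv⟩ := hv
      obtain ⟨rfl, hax⟩ := List.append_inj' hv rfl
      simp only [List.cons.injEq, Prod.mk.injEq, and_true] at hax
      obtain ⟨rfl, rfl⟩ := hax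
      simp only [viewL, List.map_append, List.map_cons, List.map_nil,
        List.append_singleton_prefix_iff, List.length_map] at hp
      refine ⟨b, M.obsL t, by simpa using hp.2, hc.2, M.final r, ?_, ?_⟩
      · exact ⟨r, hr.1, hc.1, rfl, hβ, hp.1, rfl⟩
      · simpa [final] using hr.2
  · rintro ⟨b, p, hb, ha, t, ⟨r, hr, hc, hv, hβ, hp, rfl⟩, ht, rfl, rfl⟩
    have hlen : h.length = r.length := by
      have := congrArg (fun v => v.2.length) hv
      simpa [viewH] using this.symm
    refine ⟨r ++ [((a, b), s)], (M.isRun_append_singleton _ _).2 ⟨hr, ht⟩,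
      (M.consistent_append_singleton _ _ _).2 ⟨hc, by rw [hv]; exact ha⟩, ?_, hβ, ?_, ?_⟩
    · simp only [viewH, Prod.mk.injEq] at hv
      simp [viewH, hv]
    · simp only [viewL, List.map_append, List.map_cons, List.map_nil,
        List.append_singleton_prefix_iff, List.length_map]
      exact ⟨hp, hlen ▸ hb⟩
    · simp [final]

theorem excludes_iff_Kstrat_eq_empty (M : SyncMachine S AH AL O) (π : Strategy AH O)
    (β : O × List (AL × O)) :
    M.Excludes π β ↔
      ∀ α : O × List (AH × O), α.2.length = β.2.length → M.Kstrat π α β = ∅ := by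
  constructor
  · intro hπ α hα
    rw [Set.eq_empty_iff_forall_notMem]
    rintro s ⟨r, hr, hc, rfl, hβ, hp, -⟩
    exact hπ ⟨r, hr, hc, Prod.ext hβ (hp.eq_of_length (by simpa [viewL, viewH] using hα))⟩
  · rintro hK ⟨r, hr, hc, rfl⟩
    have hmem : M.final r ∈ M.Kstrat π (M.viewH r) (M.viewL r) :=
      ⟨r, hr, hc, rfl, rfl, List.prefix_rfl, rfl⟩
    rw [hK _ (by simp [viewL, viewH])] at hmem
    exact hmem

/-- From the knowledge set `T`, agent `H` can prevent `L` from observing the continuation `l`. -/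
def CanExclude (M : SyncMachine S AH AL O) : List (AL × O) → Set S → Prop
  | [], T => T = ∅
  | (b, p) :: l, T => ∃ a : AH, ∀ x, M.CanExclude l (M.delta4 a x b p T)

theorem canExclude_empty [Nonempty AH] (M : SyncMachine S AH AL O) (l : List (AL × O)) :
    M.CanExclude l ∅ := by
  induction l with
  | nil => rfl
  | cons y l ih =>
    refine ⟨Classical.arbitrary AH, fun x => ?_⟩
    simpa [delta4] using ih

theorem canExclude_Kstrat_of_excludes (M : SyncMachine S AH AL O) {π : Strategy AH O}
    {β : O × List (AL × O)} (hπ : M.Excludes π β) (o : O) (h : List (AH × O))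
    (hle : h.length ≤ β.2.length) :
    M.CanExclude (β.2.drop h.length) (M.Kstrat π (o, h) β) := by
  generalize hl : β.2.drop h.length = l
  induction l generalizing h with
  | nil =>
    exact (M.excludes_iff_Kstrat_eq_empty π β).1 hπ (o, h)
      (le_antisymm hle (List.drop_eq_nil_iff.1 hl))
  | cons y l ih =>
    obtain ⟨b, p⟩ := y
    have hget : β.2[h.length]? = some (b, p) := by
      simpa [hl] using (List.head?_drop (l := β.2) (i := h.length)).symm
    refine ⟨π (o, h), fun x => ?_⟩
    have hlt : h.length < β.2.length := (List.getElem?_eq_some_iff.1 hget).1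
    have hK := ih (h ++ [(π (o, h), x)]) (by simpa using hlt)
      (by simp [← List.tail_drop, hl])
    rw [Kstrat_append_singleton] at hK
    simpa [hget] using hK

/-- The states `H` considers possible after a history, given most recent event first, when
playing the action `g l T` at knowledge set `T` with continuation `l` of `β` remaining. -/
def trackedKnowledge (M : SyncMachine S AH AL O) (g : List (AL × O) → Set S → AH)
    (β : O × List (AL × O)) (o : O) : List (AH × O) → Set S
  | [] => M.initialKnowledge β o
  | (a, x) :: h =>
    { s | ∃ b p, β.2[h.length]? = some (b, p) ∧
      a = g (β.2.drop h.length) (M.trackedKnowledge g β o h) ∧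
      s ∈ M.delta4 a x b p (M.trackedKnowledge g β o h) }

/-- The strategy that plays `g l T` at knowledge set `T` with continuation `l` of `β`
remaining. -/
def knowledgeStrategy (M : SyncMachine S AH AL O) (g : List (AL × O) → Set S → AH)
    (β : O × List (AL × O)) : Strategy AH O :=
  fun α => g (β.2.drop α.2.length) (M.trackedKnowledge g β α.1 α.2.reverse)

theorem Kstrat_knowledgeStrategy (M : SyncMachine S AH AL O)
    (g : List (AL × O) → Set S → AH) (β : O × List (AL × O)) (o : O) (h : List (AH × O)) :
    M.Kstrat (M.knowledgeStrategy g β) (o, h) β = M.trackedKnowledge g β o h.reverse := by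
  induction h using List.reverseRecOn with
  | nil => exact M.Kstrat_nil _ β o
  | append_singleton h y ih =>
    rw [Kstrat_append_singleton, ih]
    simp [trackedKnowledge, knowledgeStrategy]

theorem knowledgeStrategy_apply (M : SyncMachine S AH AL O)
    (g : List (AL × O) → Set S → AH) (β : O × List (AL × O)) (α : O × List (AH × O)) :
    M.knowledgeStrategy g β α =
      g (β.2.drop α.2.length) (M.Kstrat (M.knowledgeStrategy g β) α β) := by
  rw [Kstrat_knowledgeStrategy, knowledgeStrategy]

theorem canExclude_Kstrat_knowledgeStrategy [Nonempty AH] (M : SyncMachine S AH AL O)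
    {g : List (AL × O) → Set S → AH} {β : O × List (AL × O)}
    (hg : ∀ b p l T, M.CanExclude ((b, p) :: l) T →
      ∀ x, M.CanExclude l (M.delta4 (g ((b, p) :: l) T) x b p T))
    (o : O) (hinit : M.CanExclude β.2 (M.initialKnowledge β o))
    (h : List (AH × O)) (hle : h.length ≤ β.2.length) :
    M.CanExclude (β.2.drop h.length) (M.Kstrat (M.knowledgeStrategy g β) (o, h) β) := by
  induction h using List.reverseRecOn with
  | nil => simpa [Kstrat_nil] using hinit
  | append_singleton h y ih =>
    obtain ⟨a, x⟩ := y
    have hlt : h.length < β.2.length := by simpa using hle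
    have ih := ih hlt.le
    rw [Kstrat_append_singleton]
    by_cases ha : a = M.knowledgeStrategy g β (o, h)
    · have hdrop := List.drop_eq_getElem_cons hlt
      obtain ⟨b, p, hb⟩ : ∃ b p, β.2[h.length] = (b, p) := ⟨_, _, rfl⟩
      rw [hb] at hdrop
      have hwin := hg b p _ _ (hdrop ▸ ih) x
      rw [← hdrop, ← M.knowledgeStrategy_apply g β (o, h), ← ha] at hwin
      simpa [List.getElem?_eq_getElem hlt, hb, ← ha] using hwin
    · simpa [ha] using M.canExclude_empty _

end SyncMachine

open SyncMachine in
/-- Lemma 3 (normal form): if some `H` strategy excludes `β`, then some `H`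
strategy `π'` excludes `β` and takes equal values on `H` views of equal length
with equal knowledge sets `K(·, π', β)`. -/
theorem exists_normal_form_strategy {S AH AL O : Type}
    (M : SyncMachine S AH AL O) (hM : M.InputEnabled)
    (β : O × List (AL × O)) :
    (∃ π : Strategy AH O, M.Excludes π β) →
      ∃ π' : Strategy AH O, M.Excludes π' β ∧
        ∀ α α' : O × List (AH × O),
          M.Kstrat π' α β = M.Kstrat π' α' β → α.2.length = α'.2.length →
            π' α = π' α' := by
  rintro ⟨π, hπ⟩
  have : Nonempty AH := ⟨π (β.1, [])⟩
  have hex : ∀ (l : List (AL × O)) (T : Set S), ∃ a : AH, ∀ b p l', l = (b, p) :: l' →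
      M.CanExclude l T → ∀ x, M.CanExclude l' (M.delta4 a x b p T) := by
    intro l T
    by_cases hl : M.CanExclude l T
    · cases l with
      | nil => exact ⟨Classical.arbitrary AH, by simp⟩
      | cons y l =>
        obtain ⟨a, ha⟩ := hl
        refine ⟨a, ?_⟩
        rintro b p l' ⟨⟩ -
        exact ha
    · exact ⟨Classical.arbitrary AH, fun _ _ _ _ h => absurd h hl⟩
  choose g hg using hex
  refine ⟨M.knowledgeStrategy g β, ?_, fun α α' hK hlen => ?_⟩
  · rw [excludes_iff_Kstrat_eq_empty]
    rintro ⟨o, h⟩ hlen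
    have hinit := M.canExclude_Kstrat_of_excludes hπ o [] (Nat.zero_le _)
    rw [Kstrat_nil] at hinit
    have hwin := M.canExclude_Kstrat_knowledgeStrategy
      (fun b p l T => hg ((b, p) :: l) T b p l rfl) o hinit h hlen.le
    rwa [List.drop_eq_nil_of_le hlen.ge] at hwin
  · rw [M.knowledgeStrategy_apply g β α, hK, hlen, ← M.knowledgeStrategy_apply g β α']
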